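/- RIP implies restricted eigenvalue over the cone: let Xi in R^{m x hd} satisfy the (2s, delta_{2s})-block RIP with block size d, let S be a set of s block indices, and let alpha >= 0. Then for every Delta in the cone C_alpha(S) = { a in R^{hd} : ||a_{S^c}||_{2,1}^{(d)} <= alpha ||a_S||_{2,1}^{(d)} }, we have ||Xi Delta||_2^2 >= (1 - delta_{2s}(1+alpha)^2) ||Delta||_2^2. -/

import Mathlib

open Matrix Finset

def flat {h d : ℕ} (a : Fin h → Fin d → ℝ) : Fin h × Fin d → ℝ :=
  fun p => a p.1 p.2

def nsq {h d : ℕ} (a : Fin h → Fin d → ℝ) : ℝ := ∑ i, ∑ j, (a i j) ^ 2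

def vsq {m : ℕ} (v : Fin m → ℝ) : ℝ := ∑ k, (v k) ^ 2

def BlockSparse {h d : ℕ} (s : ℕ) (a : Fin h → Fin d → ℝ) : Prop :=
  ∃ T : Finset (Fin h), T.card ≤ s ∧ ∀ i ∉ T, ∀ j, a i j = 0

/-- Blockwise `ℓ_{2,1}` norm. -/
noncomputable def n21 {h d : ℕ} (a : Fin h → Fin d → ℝ) : ℝ :=
  ∑ i, Real.sqrt (∑ j, (a i j) ^ 2)

/-- Restriction of a block vector to a set of block indices. -/
def restr {h d : ℕ} (S : Finset (Fin h)) (a : Fin h → Fin d → ℝ) :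
    Fin h → Fin d → ℝ :=
  fun i j => if i ∈ S then a i j else 0

/-- A linear functional on the polytope `{x : 0 ≤ x ≤ β, ∑ x ≤ k β}` is dominated by its value at
some vertex `β • 1_T` with `#T ≤ k`. -/
theorem exists_card_le_sum_mul_le {ι : Type*} [DecidableEq ι] (R : Finset ι) (k : ℕ) (β : ℝ)
    (x c : ι → ℝ) (hx0 : ∀ i ∈ R, 0 ≤ x i) (hxβ : ∀ i ∈ R, x i ≤ β)
    (hsum : ∑ i ∈ R, x i ≤ k * β) :
    ∃ T ⊆ R, T.card ≤ k ∧ ∑ i ∈ R, x i * c i ≤ ∑ i ∈ T, β * c i := by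
  obtain ⟨T, hT, hmax⟩ := Finset.exists_max_image (R.powerset.filter (fun T => T.card ≤ k))
    (fun T => ∑ i ∈ T, c i) ⟨∅, by simp⟩
  simp only [Finset.mem_filter, Finset.mem_powerset, and_imp] at hT hmax
  obtain ⟨hTR, hTk⟩ := hT
  refine ⟨T, hTR, hTk, ?_⟩
  have hpos : ∀ i ∈ T, 0 ≤ c i := by
    intro i hi
    have h1 := hmax (T.erase i) ((Finset.erase_subset _ _).trans hTR)
      ((Finset.card_le_card (Finset.erase_subset _ _)).trans hTk)
    have h2 := Finset.add_sum_erase T c hi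
    linarith
  have hsplit (f : ι → ℝ) : ∑ i ∈ R, f i = ∑ i ∈ R \ T, f i + ∑ i ∈ T, f i :=
    (Finset.sum_sdiff hTR).symm
  obtain ⟨τ, hτ0, hτT, hτR, hτk⟩ : ∃ τ : ℝ, 0 ≤ τ ∧ (∀ i ∈ T, τ ≤ c i) ∧
      (∀ j ∈ R \ T, c j ≤ τ) ∧ τ * (k * β) = τ * (T.card * β) := by
    rcases hTk.lt_or_eq with hlt | heq
    · refine ⟨0, le_rfl, hpos, fun j hj => ?_, by simp⟩
      rw [Finset.mem_sdiff] at hj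
      have h1 := hmax (insert j T) (Finset.insert_subset hj.1 hTR)
        ((Finset.card_insert_le _ _).trans hlt)
      rw [Finset.sum_insert hj.2] at h1
      linarith
    · rcases T.eq_empty_or_nonempty with rfl | hne
      · refine ⟨∑ j ∈ R, |c j|, Finset.sum_nonneg fun _ _ => abs_nonneg _, by simp,
          fun j hj => ?_, by rw [heq]⟩
        exact (le_abs_self _).trans
          (Finset.single_le_sum (f := fun j => |c j|) (fun _ _ => abs_nonneg _)
            (Finset.mem_sdiff.1 hj).1)
      · obtain ⟨i, hi, himin⟩ := Finset.exists_min_image T c hne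
        refine ⟨c i, hpos i hi, himin, fun j hj => ?_, by rw [heq]⟩
        rw [Finset.mem_sdiff] at hj
        have hj' : j ∉ T.erase i := fun h => hj.2 (Finset.mem_of_mem_erase h)
        have h1 := hmax (insert j (T.erase i))
          (Finset.insert_subset hj.1 ((Finset.erase_subset _ _).trans hTR))
          (by rw [Finset.card_insert_of_notMem hj', Finset.card_erase_add_one hi]; exact hTk)
        rw [Finset.sum_insert hj'] at h1
        have h2 := Finset.add_sum_erase T c hi
        linarith
  have hout : ∑ i ∈ R \ T, x i * c i ≤ τ * ∑ i ∈ R \ T, x i := by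
    rw [Finset.mul_sum]
    refine Finset.sum_le_sum fun i hi => ?_
    nlinarith [hτR i hi, hx0 i (Finset.mem_sdiff.1 hi).1]
  have hin : ∑ i ∈ T, (x i * c i + τ * (β - x i)) ≤ ∑ i ∈ T, β * c i := by
    refine Finset.sum_le_sum fun i hi => ?_
    nlinarith [hτT i hi, hxβ i (hTR hi)]
  rw [Finset.sum_add_distrib, ← Finset.mul_sum, Finset.sum_sub_distrib, Finset.sum_const,
    nsmul_eq_mul] at hin
  rw [hsplit x] at hsum
  rw [hsplit]
  nlinarith [mul_le_mul_of_nonneg_left hsum hτ0]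

/-- The bilinear form of `ΞᵀΞ - 1` on block vectors. -/
def gramDefect {m h d : ℕ} (Ξ : Matrix (Fin m) (Fin h × Fin d) ℝ) :
    (Fin h → Fin d → ℝ) →ₗ[ℝ] (Fin h → Fin d → ℝ) →ₗ[ℝ] ℝ :=
  LinearMap.mk₂ ℝ
    (fun a b => Ξ.mulVec (flat a) ⬝ᵥ Ξ.mulVec (flat b) - flat a ⬝ᵥ flat b)
    (fun a a' b => by
      have : flat (a + a') = flat a + flat a' := rfl
      simp only [this, mulVec_add, add_dotProduct]; ring)
    (fun c a b => by
      have : flat (c • a) = c • flat a := rfl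
      simp only [this, mulVec_smul, smul_dotProduct, smul_eq_mul]; ring)
    (fun a b b' => by
      have : flat (b + b') = flat b + flat b' := rfl
      simp only [this, mulVec_add, dotProduct_add]; ring)
    (fun c a b => by
      have : flat (c • b) = c • flat b := rfl
      simp only [this, mulVec_smul, dotProduct_smul, smul_eq_mul]; ring)

theorem gramDefect_comm {m h d : ℕ} (Ξ : Matrix (Fin m) (Fin h × Fin d) ℝ)
    (a b : Fin h → Fin d → ℝ) : gramDefect Ξ a b = gramDefect Ξ b a := by
  simp only [gramDefect, LinearMap.mk₂_apply]
  rw [dotProduct_comm, dotProduct_comm (flat a)]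

theorem gramDefect_self {m h d : ℕ} (Ξ : Matrix (Fin m) (Fin h × Fin d) ℝ)
    (a : Fin h → Fin d → ℝ) : gramDefect Ξ a a = vsq (Ξ.mulVec (flat a)) - nsq a := by
  simp only [gramDefect, LinearMap.mk₂_apply, vsq, nsq, dotProduct, flat, ← pow_two,
    Fintype.sum_prod_type]

theorem nsq_nonneg {h d : ℕ} (a : Fin h → Fin d → ℝ) : 0 ≤ nsq a :=
  Finset.sum_nonneg fun _ _ => Finset.sum_nonneg fun _ _ => sq_nonneg _

theorem nsq_smul {h d : ℕ} (c : ℝ) (a : Fin h → Fin d → ℝ) : nsq (c • a) = c ^ 2 * nsq a := by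
  simp only [nsq, Pi.smul_apply, smul_eq_mul, mul_pow, Finset.mul_sum]

theorem nsq_add_add_nsq_sub {h d : ℕ} (a b : Fin h → Fin d → ℝ) :
    nsq (a + b) + nsq (a - b) = 2 * (nsq a + nsq b) := by
  simp only [nsq, Pi.add_apply, Pi.sub_apply, mul_add, Finset.mul_sum, ← Finset.sum_add_distrib]
  refine Finset.sum_congr rfl fun _ _ => Finset.sum_congr rfl fun _ _ => ?_
  ring

theorem eq_zero_of_nsq_eq_zero {h d : ℕ} {a : Fin h → Fin d → ℝ} (ha : nsq a = 0) : a = 0 := by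
  funext i j
  have h1 := (Finset.sum_eq_zero_iff_of_nonneg
    (fun i _ => Finset.sum_nonneg fun j _ => sq_nonneg (a i j))).1 ha i (Finset.mem_univ _)
  have h2 := (Finset.sum_eq_zero_iff_of_nonneg
    (fun j _ => sq_nonneg (a i j))).1 h1 j (Finset.mem_univ _)
  exact pow_eq_zero_iff two_ne_zero |>.1 h2

theorem nsq_restr {h d : ℕ} (S : Finset (Fin h)) (a : Fin h → Fin d → ℝ) :
    nsq (restr S a) = ∑ i ∈ S, ∑ j, (a i j) ^ 2 := by
  rw [nsq, ← Finset.sum_subset (Finset.subset_univ S)]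
  · exact Finset.sum_congr rfl fun i hi => by simp [restr, hi]
  · intro i _ hi
    simp [restr, hi]

theorem n21_restr {h d : ℕ} (S : Finset (Fin h)) (a : Fin h → Fin d → ℝ) :
    n21 (restr S a) = ∑ i ∈ S, √(∑ j, (a i j) ^ 2) := by
  rw [n21, ← Finset.sum_subset (Finset.subset_univ S)]
  · exact Finset.sum_congr rfl fun i hi => by simp [restr, hi]
  · intro i _ hi
    simp [restr, hi]

theorem n21_restr_le {h d : ℕ} (S : Finset (Fin h)) (a : Fin h → Fin d → ℝ) :
    n21 (restr S a) ≤ √S.card * √(nsq (restr S a)) := by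
  rw [n21_restr, nsq_restr, ← Real.sqrt_mul (Nat.cast_nonneg _)]
  refine Real.le_sqrt_of_sq_le (sq_sum_le_card_mul_sum_sq.trans_eq ?_)
  congr 1
  exact Finset.sum_congr rfl fun i _ => Real.sq_sqrt (Finset.sum_nonneg fun _ _ => sq_nonneg _)

/-- Bilinear consequence of a lower restricted isometry bound and an upper one, for two block
vectors with small joint support. -/
theorem neg_gramDefect_le {m h d n : ℕ} {Ξ : Matrix (Fin m) (Fin h × Fin d) ℝ} {δ : ℝ}
    (hRIP : ∀ a : Fin h → Fin d → ℝ, BlockSparse n a →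
      (1 - δ) * nsq a ≤ vsq (Ξ.mulVec (flat a)) ∧
      vsq (Ξ.mulVec (flat a)) ≤ (1 + δ) * nsq a)
    {T : Finset (Fin h)} (hT : T.card ≤ n) {a b : Fin h → Fin d → ℝ}
    (ha : ∀ i ∉ T, ∀ j, a i j = 0) (hb : ∀ i ∉ T, ∀ j, b i j = 0) :
    -gramDefect Ξ a b ≤ δ * (√(nsq a) * √(nsq b)) := by
  have key : ∀ p q : ℝ, -(p * q * gramDefect Ξ a b) ≤ δ * (p ^ 2 * nsq a + q ^ 2 * nsq b) / 2 := by
    intro p q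
    have hadd := (hRIP (p • a + q • b) ⟨T, hT, fun i hi j => by simp [ha i hi j, hb i hi j]⟩).1
    have hsub := (hRIP (p • a - q • b) ⟨T, hT, fun i hi j => by simp [ha i hi j, hb i hi j]⟩).2
    have e1 := gramDefect_self Ξ (p • a + q • b)
    have e2 := gramDefect_self Ξ (p • a - q • b)
    have e3 := nsq_add_add_nsq_sub (p • a) (q • b)
    simp only [map_add, map_sub, LinearMap.add_apply, LinearMap.sub_apply, map_smul,
      LinearMap.smul_apply, smul_eq_mul, gramDefect_comm Ξ b a] at e1 e2
    rw [nsq_smul, nsq_smul] at e3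
    have e4 : δ * (nsq (p • a + q • b) + nsq (p • a - q • b))
      = δ * (2 * (p ^ 2 * nsq a + q ^ 2 * nsq b)) := by rw [e3]
    linarith
  rcases (nsq_nonneg a).eq_or_lt with h0 | hapos
  · simp [eq_zero_of_nsq_eq_zero h0.symm, nsq]
  rcases (nsq_nonneg b).eq_or_lt with h0 | hbpos
  · simp [eq_zero_of_nsq_eq_zero h0.symm, nsq]
  have hk := key (√(nsq b)) (√(nsq a))
  have hpos : 0 < √(nsq a) * √(nsq b) := mul_pos (Real.sqrt_pos.2 hapos) (Real.sqrt_pos.2 hbpos)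
  rw [Real.sq_sqrt hapos.le, Real.sq_sqrt hbpos.le] at hk
  refine le_of_mul_le_mul_left ?_ hpos
  have : δ * (nsq b * nsq a + nsq a * nsq b) / 2
      = √(nsq a) * √(nsq b) * (δ * (√(nsq a) * √(nsq b))) := by
    linear_combination (-δ * nsq b) * Real.sq_sqrt hapos.le
      - (δ * √(nsq a) ^ 2) * Real.sq_sqrt hbpos.le
  linarith

/-- The block vector supported on `T` whose nonzero blocks are those of `a` rescaled to norm `β`. -/
noncomputable def normalizedRestr {h d : ℕ} (β : ℝ) (T : Finset (Fin h))
    (a : Fin h → Fin d → ℝ) : Fin h → Fin d → ℝ :=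
  restr T fun i j => β * ((√(∑ j, (a i j) ^ 2))⁻¹ * a i j)

theorem nsq_normalizedRestr_le {h d : ℕ} (β : ℝ) (T : Finset (Fin h))
    (a : Fin h → Fin d → ℝ) : nsq (normalizedRestr β T a) ≤ T.card * β ^ 2 := by
  rw [normalizedRestr, nsq_restr, ← nsmul_eq_mul]
  refine Finset.sum_le_card_nsmul _ _ _ fun i _ => ?_
  have h0 : 0 ≤ ∑ j, (a i j) ^ 2 := Finset.sum_nonneg fun _ _ => sq_nonneg _
  simp only [mul_pow, ← Finset.mul_sum]
  rw [inv_pow, Real.sq_sqrt h0]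
  exact mul_le_of_le_one_right (sq_nonneg β) inv_mul_le_one

theorem exists_map_restr_le_map_normalizedRestr {h d : ℕ} (R : Finset (Fin h)) (k : ℕ) (β : ℝ)
    (a : Fin h → Fin d → ℝ) (hβ : ∀ i ∈ R, √(∑ j, (a i j) ^ 2) ≤ β)
    (hsum : ∑ i ∈ R, √(∑ j, (a i j) ^ 2) ≤ k * β) (φ : (Fin h → Fin d → ℝ) →ₗ[ℝ] ℝ) :
    ∃ T : Finset (Fin h), T.card ≤ k ∧ φ (restr R a) ≤ φ (normalizedRestr β T a) := by
  set b : Fin h → ℝ := fun i => √(∑ j, (a i j) ^ 2) with hb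
  set u : Fin h → Fin h → Fin d → ℝ := fun i => Pi.single i ((b i)⁻¹ • a i) with hu
  obtain ⟨T, -, hTk, hle⟩ := exists_card_le_sum_mul_le R k β b (fun i => φ (u i))
    (fun i _ => Real.sqrt_nonneg _) hβ hsum
  have hR : restr R a = ∑ i ∈ R, b i • u i := by
    funext i j
    have hcancel : b i * ((b i)⁻¹ * a i j) = a i j := by
      by_cases h0 : b i = 0
      · have h1 : ∑ j, (a i j) ^ 2 = 0 :=
          (Real.sqrt_eq_zero (Finset.sum_nonneg fun _ _ => sq_nonneg _)).1 h0
        have h2 := (Finset.sum_eq_zero_iff_of_nonneg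
          (fun j _ => sq_nonneg (a i j))).1 h1 j (Finset.mem_univ _)
        rw [pow_eq_zero_iff two_ne_zero |>.1 h2]
        simp
      · rw [mul_inv_cancel_left₀ h0]
    simp [restr, hu, Finset.sum_apply, Pi.single_apply, ite_apply, hcancel]
  have hT : normalizedRestr β T a = ∑ i ∈ T, β • u i := by
    funext i j
    simp [normalizedRestr, restr, hu, hb, Finset.sum_apply, Pi.single_apply, ite_apply]
  refine ⟨T, hTk, ?_⟩
  rw [hR, hT]
  simpa only [map_sum, map_smul, smul_eq_mul] using hle

/-- RIP implies a restricted eigenvalue bound over the cone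
`C_α(S) = {a : ‖a_{Sᶜ}‖_{2,1} ≤ α ‖a_S‖_{2,1}}`: if `Ξ` satisfies the
`(2s, δ)`-block RIP and `|S| = s`, then for every `Δ ∈ C_α(S)`,
`‖Ξ Δ‖₂² ≥ (1 - δ(1+α)²) ‖Δ‖₂²`. -/
theorem stmt10 {m h d s : ℕ} (Ξ : Matrix (Fin m) (Fin h × Fin d) ℝ) (δ : ℝ)
    (hδ : 0 < δ) (hδ1 : δ < 1)
    (hRIP : ∀ a : Fin h → Fin d → ℝ, BlockSparse (2 * s) a →
      (1 - δ) * nsq a ≤ vsq (Ξ.mulVec (flat a)) ∧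
      vsq (Ξ.mulVec (flat a)) ≤ (1 + δ) * nsq a)
    (S : Finset (Fin h)) (hS : S.card = s) (α : ℝ) (hα : 0 ≤ α)
    (Δ : Fin h → Fin d → ℝ)
    (hcone : n21 (restr Sᶜ Δ) ≤ α * n21 (restr S Δ)) :
    (1 - δ * (1 + α) ^ 2) * nsq Δ ≤ vsq (Ξ.mulVec (flat Δ)) := by
  set b : Fin h → ℝ := fun i => √(∑ j, (Δ i j) ^ 2)
  have hb0 : ∀ i, 0 ≤ b i := fun i => Real.sqrt_nonneg _
  set x₀ : ℝ := √(nsq (restr S Δ))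
  have hx₀0 : 0 ≤ x₀ := Real.sqrt_nonneg _
  obtain ⟨β, hβ0, hsβ, hsβ2⟩ : ∃ β : ℝ, 0 ≤ β ∧ α * (√s * x₀) ≤ s * β ∧
      s * β ^ 2 ≤ (α * x₀) ^ 2 := by
    rcases Nat.eq_zero_or_pos s with h0 | hpos
    · exact ⟨0, le_rfl, by simp [h0], by simp [h0]; positivity⟩
    · have hs : 0 < √(s : ℝ) := Real.sqrt_pos.2 (Nat.cast_pos.2 hpos)
      have hsq : √(s : ℝ) ^ 2 = s := Real.sq_sqrt (Nat.cast_nonneg _)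
      refine ⟨α * x₀ / √s, by positivity, ?_, ?_⟩
      · rw [← hsq, Real.sqrt_sq hs.le]
        field_simp
        exact le_rfl
      · rw [div_pow, hsq]
        field_simp
        exact le_rfl
  have htail : ∑ i ∈ Sᶜ, b i ≤ s * β := by
    rw [← n21_restr]
    refine (hcone.trans (mul_le_mul_of_nonneg_left (n21_restr_le S Δ) hα)).trans ?_
    rw [hS]
    exact hsβ
  -- `B` collects the large blocks outside `S`, `R` the remaining ones.
  set B := Sᶜ.filter (fun i => β < b i) with hB
  set R := Sᶜ.filter (fun i => ¬ β < b i) with hR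
  have hBR : ∑ i ∈ B, b i + ∑ i ∈ R, b i = ∑ i ∈ Sᶜ, b i :=
    Finset.sum_filter_add_sum_filter_not _ _ _
  have hBβ : B.card * β ≤ ∑ i ∈ B, b i := by
    rw [← nsmul_eq_mul]
    exact Finset.card_nsmul_le_sum _ _ _ fun i hi => (Finset.mem_filter.1 hi).2.le
  have hR0 : 0 ≤ ∑ i ∈ R, b i := Finset.sum_nonneg fun i _ => hb0 i
  have hBs : B.card ≤ s := by
    rcases hβ0.eq_or_lt with h0 | hpos
    · have hBempty : B = ∅ := by
        refine Finset.filter_eq_empty_iff.2 fun i hi => not_lt.2 ?_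
        have := Finset.single_le_sum (f := b) (fun i _ => hb0 i) hi
        rw [← h0] at htail ⊢
        linarith
      simp [hBempty]
    · have : (B.card : ℝ) * β ≤ s * β := by linarith
      exact_mod_cast le_of_mul_le_mul_right this hpos
  obtain ⟨k, hk⟩ := Nat.exists_eq_add_of_le hBs
  have hkR : (s : ℝ) = B.card + k := by exact_mod_cast hk
  have hRsum : ∑ i ∈ R, b i ≤ k * β := by
    rw [hkR] at htail
    linarith
  have hvertex := exists_map_restr_le_map_normalizedRestr R k β Δ
    (fun i hi => not_lt.1 (Finset.mem_filter.1 hi).2) hRsum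
  have hnorm : ∀ T : Finset (Fin h), T.card ≤ k → √(nsq (normalizedRestr β T Δ)) ≤ α * x₀ := by
    intro T hT
    refine Real.sqrt_le_iff.2 ⟨by positivity, (nsq_normalizedRestr_le β T Δ).trans ?_⟩
    refine le_trans (mul_le_mul_of_nonneg_right ?_ (sq_nonneg β)) hsβ2
    exact_mod_cast hT.trans (by omega)
  have hsupp : ∀ (T T' : Finset (Fin h)) (a : Fin h → Fin d → ℝ), T ⊆ T' →
      ∀ i ∉ T', ∀ j, restr T a i j = 0 := fun T T' a hTT i hi j =>
    if_neg fun hiT => hi (hTT hiT)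
  set U := restr (S ∪ B) Δ with hU
  set V := restr R Δ with hV
  have hdecomp : Δ = U + V := by
    funext i j
    by_cases hiS : i ∈ S <;> by_cases hib : β < b i <;> simp [hU, hV, restr, hB, hR, hiS, hib]
  have hcard : (S ∪ B).card ≤ s + B.card := (Finset.card_union_le _ _).trans_eq (by rw [hS])
  have hUU : -gramDefect Ξ U U ≤ δ * (√(nsq U) * √(nsq U)) :=
    neg_gramDefect_le hRIP (T := S ∪ B) (by omega) (hsupp _ _ _ subset_rfl)
      (hsupp _ _ _ subset_rfl)
  have hUV : -gramDefect Ξ U V ≤ δ * (√(nsq U) * (α * x₀)) := by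
    obtain ⟨T, hT, hle⟩ := hvertex (-gramDefect Ξ U)
    have hTcard : ((S ∪ B) ∪ T).card ≤ 2 * s := (Finset.card_union_le _ _).trans (by omega)
    refine (hle.trans (neg_gramDefect_le hRIP hTcard (hsupp _ _ _ Finset.subset_union_left)
      (hsupp _ _ _ Finset.subset_union_right))).trans ?_
    gcongr
    exact hnorm T hT
  have hVV : -gramDefect Ξ V V ≤ δ * ((α * x₀) * (α * x₀)) := by
    obtain ⟨T, hT, hle⟩ := hvertex (-gramDefect Ξ V)
    obtain ⟨T', hT', hle'⟩ := hvertex (-gramDefect Ξ (normalizedRestr β T Δ))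
    simp only [LinearMap.neg_apply] at hle hle'
    rw [gramDefect_comm Ξ V (normalizedRestr β T Δ)] at hle
    have hTcard : (T ∪ T').card ≤ 2 * s := (Finset.card_union_le _ _).trans (by omega)
    refine ((hle.trans hle').trans (neg_gramDefect_le hRIP hTcard
      (hsupp _ _ _ Finset.subset_union_left) (hsupp _ _ _ Finset.subset_union_right))).trans ?_
    gcongr
    · exact hnorm T hT
    · exact hnorm T' hT'
  have hmono : ∀ T T' : Finset (Fin h), T ⊆ T' → nsq (restr T Δ) ≤ nsq (restr T' Δ) := by
    intro T T' hTT
    rw [nsq_restr, nsq_restr]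
    exact Finset.sum_le_sum_of_subset_of_nonneg hTT
      fun _ _ _ => Finset.sum_nonneg fun _ _ => sq_nonneg _
  have hxU : x₀ ≤ √(nsq U) := Real.sqrt_le_sqrt (hmono _ _ Finset.subset_union_left)
  have hUΔ : √(nsq U) ^ 2 ≤ nsq Δ := by
    rw [Real.sq_sqrt (nsq_nonneg _)]
    refine (hmono _ _ (Finset.subset_univ _)).trans_eq ?_
    rw [nsq_restr, nsq]
  have hexpand : gramDefect Ξ Δ Δ
      = gramDefect Ξ U U + 2 * gramDefect Ξ U V + gramDefect Ξ V V := by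
    rw [hdecomp]
    simp only [map_add, LinearMap.add_apply, gramDefect_comm Ξ V U]
    ring
  have hbound : (√(nsq U) + α * x₀) ^ 2 ≤ (1 + α) ^ 2 * nsq Δ := by
    calc (√(nsq U) + α * x₀) ^ 2 ≤ (√(nsq U) + α * √(nsq U)) ^ 2 := by gcongr
      _ = (1 + α) ^ 2 * √(nsq U) ^ 2 := by ring
      _ ≤ (1 + α) ^ 2 * nsq Δ := by gcongr
  have hself := gramDefect_self Ξ Δ
  nlinarith [mul_le_mul_of_nonneg_left hbound hδ.le]
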